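/- For every positive integer n, the cyclic group ℤ/nℤ possesses the weak acyclic matching property: for all nonempty subsets A, B ⊆ ℤ/nℤ with |A| = |B| and A ∩ (A + B) = ∅, there exists an acyclic matching from A to B. -/

import Mathlib

open Finset Pointwise

/-- A matching from `A` to `B` is a bijection `f : A → B` with `a + f a ∉ A` for all `a ∈ A`. -/
def IsMatchingFrom {G : Type*} [AddCommGroup G] (A B : Finset G) (f : A ≃ B) : Prop :=
  ∀ a : A, (a : G) + (f a : G) ∉ A

/-- The multiplicity function of a bijection `f : A → B`:
`m_f x = |{a ∈ A : a + f a = x}|`. -/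
noncomputable def multiplicityFn {G : Type*} [AddCommGroup G] (A B : Finset G)
    (f : A ≃ B) : G → ℕ :=
  fun x => Nat.card {a : A // (a : G) + (f a : G) = x}

/-- A matching `f : A → B` is acyclic if every matching `g : A → B` with `m_g = m_f`
equals `f`. -/
def IsAcyclicMatchingFrom {G : Type*} [AddCommGroup G] (A B : Finset G) (f : A ≃ B) : Prop :=
  IsMatchingFrom A B f ∧
    ∀ g : A ≃ B, IsMatchingFrom A B g → multiplicityFn A B g = multiplicityFn A B f → g = f

/-- If `f` sends `a` to `x - a` whenever this lies in `B`, then any injection `g` from `A` to `B`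
with at least as many pairs of sum `x` does so too. -/
theorem eq_sub_of_card_sum_eq {G : Type*} [AddCommGroup G] [DecidableEq G] {A B : Finset G}
    {f g : G → G} {x : G} (hf : ∀ a ∈ A, x - a ∈ B → f a = x - a) (hg : ∀ a ∈ A, g a ∈ B)
    (h : #{a ∈ A | a + f a = x} ≤ #{a ∈ A | a + g a = x}) {a : G} (ha : a ∈ A)
    (hxa : x - a ∈ B) : g a = x - a := by
  have hsub : {a ∈ A | a + g a = x} ⊆ {a ∈ A | x - a ∈ B} := by
    intro c hc
    rw [mem_filter] at hc ⊢
    refine ⟨hc.1, ?_⟩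
    rw [← hc.2, add_sub_cancel_left]
    exact hg c hc.1
  have hsub' : {a ∈ A | x - a ∈ B} ⊆ {a ∈ A | a + f a = x} := by
    intro c hc
    rw [mem_filter] at hc ⊢
    refine ⟨hc.1, ?_⟩
    rw [hf c hc.1 hc.2, add_sub_cancel]
  have heq := eq_of_subset_of_card_le hsub ((card_le_card hsub').trans h)
  have hmem : a ∈ ({a ∈ A | a + g a = x} : Finset G) := by
    rw [heq, mem_filter]
    exact ⟨ha, hxa⟩
  exact eq_sub_of_add_eq' (mem_filter.mp hmem).2

/-- If `#A ≤ #B`, some injection from `A` to `B` is determined by the multiplicities of the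
sums `a + f a`. -/
theorem exists_injOn_determined_by_sums {G : Type*} [AddCommGroup G] [DecidableEq G]
    (A B : Finset G) (hcard : #A ≤ #B) :
    ∃ f : G → G, (∀ a ∈ A, f a ∈ B) ∧ Set.InjOn f A ∧
      ∀ g : G → G, (∀ a ∈ A, g a ∈ B) → Set.InjOn g A →
        (∀ x, #{a ∈ A | a + g a = x} = #{a ∈ A | a + f a = x}) → ∀ a ∈ A, g a = f a := by
  induction A using Finset.strongInduction generalizing B with
  | H A ih =>
  obtain rfl | ⟨a₀, ha₀⟩ := A.eq_empty_or_nonempty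
  · exact ⟨id, by simp⟩
  obtain ⟨b₀, hb₀⟩ : B.Nonempty := card_pos.mp ((card_pos.mpr ⟨a₀, ha₀⟩).trans_le hcard)
  set x := a₀ + b₀ with hx
  have hlt : {a ∈ A | x - a ∉ B} ⊂ A :=
    filter_ssubset.mpr ⟨a₀, ha₀, by simpa [hx] using hb₀⟩
  have hle : #{a ∈ A | x - a ∉ B} ≤ #{b ∈ B | x - b ∉ A} := by
    have h₁ := card_filter_add_card_filter_not (s := A) (fun a => x - a ∈ B)
    have h₂ := card_filter_add_card_filter_not (s := B) (fun b => x - b ∈ A)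
    have h₃ : #{b ∈ B | x - b ∈ A} ≤ #{a ∈ A | x - a ∈ B} :=
      card_le_card_of_injOn (fun b => x - b)
        (fun b hb => by simp_all) (fun b _ c _ h => sub_right_injective h)
    omega
  obtain ⟨f, hfB, hfinj, hf⟩ := ih _ hlt _ hle
  simp only [mem_filter] at hfB
  have hFB : ∀ a ∈ A, (if x - a ∈ B then x - a else f a) ∈ B := by
    intro a ha
    split_ifs with h
    · exact h
    · exact (hfB a ⟨ha, h⟩).1
  refine ⟨fun a => if x - a ∈ B then x - a else f a, hFB, ?_, ?_⟩
  · intro a ha c hc hac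
    rw [mem_coe] at ha hc
    dsimp only at hac
    split_ifs at hac with h h' h'
    · exact sub_right_injective hac
    · refine absurd ?_ (hfB c ⟨hc, h'⟩).2
      rwa [← hac, sub_sub_cancel]
    · refine absurd ?_ (hfB a ⟨ha, h⟩).2
      rwa [hac, sub_sub_cancel]
    · exact hfinj (by simp [ha, h]) (by simp [hc, h']) hac
  · intro g hgB hginj hg
    have hgx : ∀ a ∈ A, x - a ∈ B → g a = x - a := fun a ha h =>
      eq_sub_of_card_sum_eq (fun c _ hc => if_pos hc) hgB (hg x).ge ha h
    have hrest : ∀ a ∈ ({a ∈ A | x - a ∉ B} : Finset G), g a = f a := by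
      refine hf g ?_ (hginj.mono (coe_subset.mpr (filter_subset _ _))) ?_
      · intro a ha
        rw [mem_filter] at ha ⊢
        refine ⟨hgB a ha.1, fun h => ha.2 ?_⟩
        have hga : g (x - g a) = g a := by
          rw [hgx _ h (by simpa using hgB a ha.1), sub_sub_cancel]
        rw [← hginj h ha.1 hga, sub_sub_cancel]
        exact hgB a ha.1
      · intro y
        have split (k : G → G) : #{a ∈ A | a + k a = y} =
            #{a ∈ A | x - a ∈ B ∧ a + k a = y} + #{a ∈ A | x - a ∉ B ∧ a + k a = y} := by
          rw [← card_filter_add_card_filter_not (s := {a ∈ A | a + k a = y})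
            (fun a => x - a ∈ B), filter_filter, filter_filter]
          simp only [and_comm]
        have hy := hg y
        rw [split g, split fun a => if x - a ∈ B then x - a else f a] at hy
        have h₁ : ({a ∈ A | x - a ∈ B ∧ a + g a = y} : Finset G) =
            {a ∈ A | x - a ∈ B ∧ a + (if x - a ∈ B then x - a else f a) = y} :=
          filter_congr fun a ha => and_congr_right fun h => by rw [hgx a ha h, if_pos h]
        have h₂ : ({a ∈ A | x - a ∉ B ∧ a + (if x - a ∈ B then x - a else f a) = y} : Finset G) =
            {a ∈ A | x - a ∉ B ∧ a + f a = y} :=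
          filter_congr fun a _ => and_congr_right fun h => by rw [if_neg h]
        rw [h₁, h₂] at hy
        rw [filter_filter, filter_filter]
        exact Nat.add_left_cancel hy
    intro a ha
    dsimp only
    split_ifs with h
    · exact hgx a ha h
    · exact hrest a (mem_filter.mpr ⟨ha, h⟩)

theorem multiplicityFn_eq_card_filter {G : Type*} [AddCommGroup G] [DecidableEq G]
    {A B : Finset G} (f : A ≃ B) {k : G → G} (hk : ∀ a : A, k a = f a) (x : G) :
    multiplicityFn A B f x = #{a ∈ A | a + k a = x} := by
  rw [multiplicityFn, ← Nat.card_eq_finsetCard]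
  refine Nat.card_congr ((Equiv.subtypeEquivRight fun a => by rw [← hk a]).trans
    ((Equiv.subtypeSubtypeEquivSubtypeInter (· ∈ A) fun a => a + k a = x).trans
      (Equiv.subtypeEquivRight fun a => by rw [mem_filter])))

/-- In any abelian group, finite sets `A` and `B` of equal size with `A` disjoint from `A + B`
admit an acyclic matching. -/
theorem exists_isAcyclicMatchingFrom {G : Type*} [AddCommGroup G] [DecidableEq G]
    {A B : Finset G} (hcard : #A = #B) (hdisj : Disjoint A (A + B)) :
    ∃ f : A ≃ B, IsAcyclicMatchingFrom A B f := by
  obtain ⟨k, hkB, hkinj, hk⟩ := exists_injOn_determined_by_sums A B hcard.le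
  let F : A → B := fun a => ⟨k a, hkB a a.2⟩
  have hF : Function.Bijective F := by
    rw [Fintype.bijective_iff_injective_and_card]
    exact ⟨fun a c h => Subtype.ext (hkinj a.2 c.2 (congrArg Subtype.val h)), by simpa using hcard⟩
  refine ⟨Equiv.ofBijective F hF, fun a ha =>
    disjoint_left.mp hdisj ha (add_mem_add a.2 (Subtype.prop _)), fun g _ hg => ?_⟩
  let l : G → G := fun a => if h : a ∈ A then g ⟨a, h⟩ else 0
  have hl (a : A) : l a = g a := by simp [l]
  have hlk : ∀ a ∈ A, l a = k a := by
    refine hk l (fun a ha => ?_) (fun a ha c hc h => ?_) fun x => ?_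
    · rw [hl ⟨a, ha⟩]
      exact Subtype.prop _
    · rw [hl ⟨a, ha⟩, hl ⟨c, hc⟩] at h
      exact congrArg Subtype.val (g.injective (Subtype.ext h))
    · rw [← multiplicityFn_eq_card_filter g hl, hg]
      exact multiplicityFn_eq_card_filter _ (fun _ => rfl) x
  ext a
  rw [← hl a]
  exact hlk a a.2

/-- For every positive integer `n`, the cyclic group `ℤ/nℤ` possesses the
weak acyclic matching property. -/
theorem zmod_weak_acyclic_matching_property (n : ℕ) (hn : 0 < n)
    (A B : Finset (ZMod n)) (hA : A.Nonempty) (hB : B.Nonempty)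
    (hcard : A.card = B.card) (hdisj : A ∩ (A + B) = ∅) :
    ∃ f : A ≃ B, IsAcyclicMatchingFrom A B f := by
  exact exists_isAcyclicMatchingFrom hcard (disjoint_iff_inter_eq_empty.mpr hdisj)
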